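/- arXiv:1308.5856 — 2 statements merged into one kernel-verified Lean document; each statement's English description precedes it below -/
import Mathlib

section
/- Under the hypotheses of the presentation of M(N_{g,0}) — i.e. G a group with a_1, ..., a_{g-1}, u_1, ..., u_{g-1} satisfying the braid relations in each family, a_i u_j = u_j a_i for |i-j|>1, a_i u_{i+1} u_i = u_{i+1} u_i a_{i+1}, a_{i+1} u_i u_{i+1} = u_i u_{i+1} a_i, a_1 u_1 a_1 = u_1, u_2 a_1 a_2 u_1 = a_1 a_2, (u_{g-1}⋯u_1)(u_1⋯u_{g-1}) = 1, (u_1⋯u_{g-1})^g = 1, and a_1 (a_2⋯a_{g-1} u_{g-1}⋯u_2) a_1 = a_2⋯a_{g-1} u_{g-1}⋯u_2 — one has (a_1 ⋯ a_{g-1})^k = 1, where k = g if g is even and k = 2g if g is odd. -/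
variable {G : Type*} [Group G]

/-- `prodAsc f m = f 1 * f 2 * ⋯ * f m` (empty product for `m = 0`). -/
def prodAsc (f : ℕ → G) (m : ℕ) : G :=
  ((List.range m).map (fun i => f (i + 1))).prod

/-- `prodDesc f m = f m * ⋯ * f 2 * f 1` (empty product for `m = 0`). -/
def prodDesc (f : ℕ → G) (m : ℕ) : G :=
  (((List.range m).reverse).map (fun i => f (i + 1))).prod

/-- The fundamental braid element: `Δ 0 = Δ 1 = 1`, `Δ (m+1) = (u 1 ⋯ u m) * Δ m`. -/
def braidDelta (u : ℕ → G) : ℕ → G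
  | 0 => 1
  | m + 1 => prodAsc u m * braidDelta u m

theorem asc_succ (f : ℕ → G) (m : ℕ) : prodAsc f (m+1) = prodAsc f m * f (m+1) := by
  simp [prodAsc, List.range_succ]

theorem desc_succ (f : ℕ → G) (m : ℕ) : prodDesc f (m+1) = f (m+1) * prodDesc f m := by
  simp [prodDesc, List.range_succ]

theorem asc_zero (f : ℕ → G) : prodAsc f 0 = 1 := by simp [prodAsc]

theorem desc_zero (f : ℕ → G) : prodDesc f 0 = 1 := by simp [prodDesc]

theorem asc_cons (f : ℕ → G) (m : ℕ) :
    prodAsc f (m+1) = f 1 * ((List.range m).map (fun i => f (i + 2))).prod := by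
  simp [prodAsc, List.range_succ_eq_map, Function.comp_def]

theorem desc_cons (f : ℕ → G) (m : ℕ) :
    prodDesc f (m+1) = (((List.range m).reverse).map (fun i => f (i + 2))).prod * f 1 := by
  simp [prodDesc, List.range_succ_eq_map, Function.comp_def]

theorem asc_comm (x : ℕ → G) (c : G) (m : ℕ)
    (h : ∀ j, 1 ≤ j → j ≤ m → x j * c = c * x j) : prodAsc x m * c = c * prodAsc x m := by
  induction m with
  | zero => simp [asc_zero]
  | succ m ih =>
    rw [asc_succ, mul_assoc, h (m+1) (by omega) le_rfl, ← mul_assoc,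
      ih (fun j h1 h2 => h j h1 (by omega)), mul_assoc]

theorem desc_comm (x : ℕ → G) (c : G) (m : ℕ)
    (h : ∀ j, 1 ≤ j → j ≤ m → x j * c = c * x j) : prodDesc x m * c = c * prodDesc x m := by
  induction m with
  | zero => simp [desc_zero]
  | succ m ih =>
    rw [desc_succ, mul_assoc, ih (fun j h1 h2 => h j h1 (by omega)), ← mul_assoc,
      h (m+1) (by omega) le_rfl, mul_assoc]

theorem delta_comm (x : ℕ → G) (c : G) (m : ℕ)
    (h : ∀ j, 1 ≤ j → j + 1 ≤ m → x j * c = c * x j) :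
    braidDelta x m * c = c * braidDelta x m := by
  induction m with
  | zero => simp [braidDelta]
  | succ m ih =>
    rw [braidDelta, mul_assoc, ih (fun j h1 h2 => h j h1 (by omega)), ← mul_assoc,
      asc_comm x c m (fun j h1 h2 => h j h1 (by omega)), mul_assoc]

theorem asc_shift (x b c : ℕ → G) (n : ℕ)
    (h1 : ∀ i j, 1 ≤ j → j + 2 ≤ i → i ≤ n → x j * c i = c i * x j)
    (h2 : ∀ i j, 1 ≤ i → i + 2 ≤ j → j ≤ n → x j * b i = b i * x j)
    (h3 : ∀ i, 1 ≤ i → i + 1 ≤ n → x i * x (i+1) * b i = c (i+1) * (x i * x (i+1)))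
    (m i : ℕ) (hi : 1 ≤ i) (him : i + 1 ≤ m) (hm : m ≤ n) :
    prodAsc x m * b i = c (i+1) * prodAsc x m := by
  induction m with
  | zero => omega
  | succ m ih =>
    rcases Nat.lt_or_ge i m with h | h
    · rw [asc_succ, mul_assoc, h2 i (m+1) hi (by omega) hm, ← mul_assoc,
        ih (by omega) (by omega), mul_assoc]
    · obtain rfl : m = i := by omega
      obtain ⟨k, rfl⟩ : ∃ k, m = k + 1 := ⟨m - 1, by omega⟩
      rw [asc_succ, asc_succ, mul_assoc (prodAsc x k), mul_assoc (prodAsc x k), h3 _ hi hm,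
        ← mul_assoc, asc_comm x (c (k+1+1)) k (fun j a1 a2 => h1 _ _ a1 (by omega) hm), mul_assoc]

theorem desc_shift (x b : ℕ → G) (n : ℕ)
    (h1 : ∀ i j, 1 ≤ j → j + 2 ≤ i → i ≤ n → x j * b i = b i * x j)
    (h2 : ∀ i j, 1 ≤ i → i + 2 ≤ j → j ≤ n → x j * b i = b i * x j)
    (h3 : ∀ i, 1 ≤ i → i + 1 ≤ n → x (i+1) * x i * b (i+1) = b i * (x (i+1) * x i))
    (m i : ℕ) (hi : 1 ≤ i) (him : i + 1 ≤ m) (hm : m ≤ n) :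
    prodDesc x m * b (i+1) = b i * prodDesc x m := by
  induction m with
  | zero => omega
  | succ m ih =>
    rcases Nat.lt_or_ge i m with h | h
    · rw [desc_succ, mul_assoc, ih (by omega) (by omega), ← mul_assoc,
        h2 i (m+1) hi (by omega) hm, mul_assoc]
    · obtain rfl : m = i := by omega
      obtain ⟨k, rfl⟩ : ∃ k, m = k + 1 := ⟨m - 1, by omega⟩
      rw [desc_succ, desc_succ, ← mul_assoc, mul_assoc (x (k+1+1) * x (k+1)),
        desc_comm x (b (k+1+1)) k (fun j a1 a2 => h1 _ _ a1 (by omega) hm),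
        ← mul_assoc, h3 _ hi hm, mul_assoc]

theorem delta_rev (n : ℕ) (u : ℕ → G)
    (hu1 : ∀ i j, 1 ≤ i → i + 2 ≤ j → j ≤ n → u i * u j = u j * u i)
    (m : ℕ) (hm : m ≤ n) :
    prodAsc u m * braidDelta u m = braidDelta u m * prodDesc u m := by
  induction m with
  | zero => simp [asc_zero, desc_zero, braidDelta]
  | succ m ih =>
    have ih := ih (by omega)
    have e : braidDelta u (m+1) = prodAsc u m * braidDelta u m := rfl
    have hc := delta_comm u (u (m+1)) m (fun j a b => hu1 _ _ a (by omega) hm)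
    calc prodAsc u (m+1) * braidDelta u (m+1)
        = prodAsc u m * (u (m+1) * braidDelta u m) * prodDesc u m := by
          rw [e, ih, asc_succ]; simp only [mul_assoc]
      _ = _ := by rw [← hc, e, desc_succ]; simp only [mul_assoc]

theorem pow_aux1 (u : ℕ → G) (m : ℕ)
    (hs : ∀ i, 1 ≤ i → i + 1 ≤ m + 1 →
      prodAsc u (m+1) * u i = u (i+1) * prodAsc u (m+1)) (k : ℕ) :
    ∀ j, j + k = m → prodDesc u (m+1) * (prodDesc u (j+1))⁻¹ * prodAsc u (m+1) =
      prodAsc u (m+1) * prodDesc u m * (prodDesc u j)⁻¹ := by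
  induction k with
  | zero => intro j hj; obtain rfl : j = m := by omega
            simp
  | succ k ih =>
    intro j hj
    have h := ih (j+1) (by omega)
    have e1 : (prodDesc u (j+1))⁻¹ = (prodDesc u (j+1+1))⁻¹ * u (j+1+1) := by
      rw [desc_succ u (j+1)]; group
    have e2 : (prodDesc u j)⁻¹ = (prodDesc u (j+1))⁻¹ * u (j+1) := by
      rw [desc_succ u j]; group
    rw [e2, ← mul_assoc, ← h, e1, mul_assoc _ _ (u (j+1)), hs (j+1) (by omega) (by omega)]
    simp only [mul_assoc]

theorem pow_aux2 (u : ℕ → G) (m : ℕ)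
    (hs : ∀ i, 1 ≤ i → i + 1 ≤ m + 1 →
      prodAsc u (m+1) * u i = u (i+1) * prodAsc u (m+1)) (k : ℕ) :
    ∀ j, j + k = m + 1 → prodAsc u (m+1) ^ k =
      prodAsc u m ^ k * (prodDesc u (m+1) * (prodDesc u j)⁻¹) := by
  induction k with
  | zero => intro j hj; obtain rfl : j = m + 1 := by omega
            simp
  | succ k ih =>
    intro j hj
    rw [pow_succ, ih (j+1) (by omega), mul_assoc, pow_aux1 u m hs k j (by omega), asc_succ,
      desc_succ u m, pow_succ]
    simp only [mul_assoc]

theorem delta_sq (n : ℕ) (u : ℕ → G)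
    (hu1 : ∀ i j, 1 ≤ i → i + 2 ≤ j → j ≤ n → u i * u j = u j * u i)
    (hs : ∀ m i, 1 ≤ i → i + 1 ≤ m → m ≤ n → prodAsc u m * u i = u (i+1) * prodAsc u m)
    (hd : ∀ m i, 1 ≤ i → i + 1 ≤ m → m ≤ n → prodDesc u m * u (i+1) = u i * prodDesc u m)
    (m : ℕ) (hm : m ≤ n) :
    braidDelta u (m+1) * braidDelta u (m+1) = prodAsc u m ^ (m+1) := by
  induction m with
  | zero => simp [asc_zero, braidDelta]
  | succ m ih =>
    have ih := ih (by omega)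
    have e : braidDelta u (m+1+1) = prodAsc u (m+1) * braidDelta u (m+1) := rfl
    have r := delta_rev n u hu1 (m+1) hm
    have c := delta_comm u (prodDesc u (m+1) * prodAsc u (m+1)) (m+1) (fun j a b => by
      rw [mul_assoc (prodDesc u (m+1)), hs _ _ a b hm, ← mul_assoc, ← mul_assoc, hd _ _ a b hm])
    have p := pow_aux2 u m (fun i a b => hs _ _ a b hm) (m+1) 0 (by omega)
    rw [desc_zero, inv_one, mul_one, ← ih] at p
    rw [pow_succ, p]
    calc braidDelta u (m+1+1) * braidDelta u (m+1+1)
        = braidDelta u (m+1) * (prodDesc u (m+1) * prodAsc u (m+1) * braidDelta u (m+1)) := by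
          nth_rw 1 [e]; rw [r, e]; simp only [mul_assoc]
      _ = _ := by rw [← c]; simp only [mul_assoc]

theorem delta_conj (n : ℕ) (a u : ℕ → G)
    (hu1 : ∀ i j, 1 ≤ i → i + 2 ≤ j → j ≤ n → u i * u j = u j * u i)
    (hs : ∀ m i, 1 ≤ i → i + 1 ≤ m → m ≤ n → prodAsc u m * a i = a (i+1) * prodAsc u m)
    (hd : ∀ m i, 1 ≤ i → i + 1 ≤ m → m ≤ n → prodDesc u m * a (i+1) = a i * prodDesc u m)
    (h1 : a 1 * u 1 * a 1 = u 1) (m : ℕ) (hm : m ≤ n) :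
    ∀ i j, 1 ≤ i → 1 ≤ j → i + j = m + 1 →
      a j * braidDelta u (m+1) * a i = braidDelta u (m+1) := by
  induction m with
  | zero => intro i j _ _ _; omega
  | succ m ih =>
    have ih := ih (by omega)
    have e : braidDelta u (m+1+1) = prodAsc u (m+1) * braidDelta u (m+1) := rfl
    have r := delta_rev n u hu1 (m+1) hm
    intro i j hi hj hij
    by_cases h : 2 ≤ j
    · obtain ⟨j, rfl⟩ : ∃ k, j = k + 1 := ⟨j - 1, by omega⟩
      rw [e, ← mul_assoc, ← hs (m+1) j (by omega) (by omega) hm, mul_assoc, mul_assoc,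
        ← mul_assoc (a j), ih i j hi (by omega) (by omega)]
    · obtain rfl : j = 1 := by omega
      by_cases h2 : 2 ≤ i
      · obtain ⟨i, rfl⟩ : ∃ k, i = k + 1 := ⟨i - 1, by omega⟩
        rw [e, r, mul_assoc, mul_assoc, hd (m+1) i (by omega) (by omega) hm, ← mul_assoc,
          ← mul_assoc, ih i 1 (by omega) (by omega) (by omega)]
      · obtain rfl : i = 1 := by omega
        obtain rfl : m = 0 := by omega
        simpa [e, asc_succ, asc_zero, braidDelta] using h1

theorem flip_asc (n : ℕ) (a : ℕ → G) (D : G)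
    (h : ∀ i j, 1 ≤ i → 1 ≤ j → i + j = n + 1 → a j * D * a i = D) (k : ℕ) :
    ∀ l, l + k = n → prodAsc a l * D = prodAsc a n * D * prodAsc a k := by
  induction k with
  | zero => intro l hl; obtain rfl : l = n := by omega
            simp [asc_zero]
  | succ k ih =>
    intro l hl
    have h1 := ih (l+1) (by omega)
    rw [asc_succ a k, ← mul_assoc, ← h1, asc_succ, mul_assoc, mul_assoc, ← mul_assoc (a (l+1)),
      h (k+1) (l+1) (by omega) (by omega) (by omega)]

theorem inv_asc (n : ℕ) (u : ℕ → G) (W : G)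
    (h : ∀ i, 1 ≤ i → i ≤ n → u i * W * u i = W) (m : ℕ) (hm : m ≤ n) :
    prodDesc u m * W * prodAsc u m = W := by
  induction m with
  | zero => simp [asc_zero, desc_zero]
  | succ m ih =>
    rw [asc_succ, desc_succ]
    calc _ = u (m+1) * (prodDesc u m * W * prodAsc u m) * u (m+1) := by simp only [mul_assoc]
      _ = W := by rw [ih (by omega), h _ (by omega) hm]

theorem inv_delta (n : ℕ) (u : ℕ → G) (W : G)
    (hu1 : ∀ i j, 1 ≤ i → i + 2 ≤ j → j ≤ n → u i * u j = u j * u i)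
    (h : ∀ i, 1 ≤ i → i ≤ n → u i * W * u i = W) (m : ℕ) (hm : m ≤ n) :
    braidDelta u (m+1) * W * braidDelta u (m+1) = W := by
  induction m with
  | zero => simp [asc_zero, braidDelta]
  | succ m ih =>
    have e : braidDelta u (m+1+1) = prodAsc u (m+1) * braidDelta u (m+1) := rfl
    have r := delta_rev n u hu1 (m+1) hm
    have h1 := inv_asc n u W h (m+1) hm
    calc _ = braidDelta u (m+1) * (prodDesc u (m+1) * W * prodAsc u (m+1))
              * braidDelta u (m+1) := by
          nth_rw 1 [e]; rw [r, e]; simp only [mul_assoc]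
      _ = W := by rw [h1, ih (by omega)]

/-- Relation (E5), with `n = p + 2 = g - 1`. -/
theorem rel_E5 (p : ℕ) (a u : ℕ → G)
    (ha1 : ∀ i j, 1 ≤ i → i + 2 ≤ j → j ≤ p+2 → a i * a j = a j * a i)
    (ha2 : ∀ i, 1 ≤ i → i + 1 ≤ p+2 → a i * a (i + 1) * a i = a (i + 1) * a i * a (i + 1))
    (hu1 : ∀ i j, 1 ≤ i → i + 2 ≤ j → j ≤ p+2 → u i * u j = u j * u i)
    (hu2 : ∀ i, 1 ≤ i → i + 1 ≤ p+2 → u i * u (i + 1) * u i = u (i + 1) * u i * u (i + 1))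
    (hC1 : ∀ i j, 1 ≤ i → i ≤ p+2 → 1 ≤ j → j ≤ p+2 → (i + 2 ≤ j ∨ j + 2 ≤ i) →
      a i * u j = u j * a i)
    (hC2 : ∀ i, 1 ≤ i → i ≤ p+1 → a i * u (i + 1) * u i = u (i + 1) * u i * a (i + 1))
    (hC3 : ∀ i, 1 ≤ i → i ≤ p+1 → a (i + 1) * u i * u (i + 1) = u i * u (i + 1) * a i)
    (hC4 : a 1 * u 1 * a 1 = u 1)
    (hC5 : u 2 * a 1 * a 2 * u 1 = a 1 * a 2)
    (hB4a : prodDesc u (p+2) * prodAsc u (p+2) = 1)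
    (hB3 : (prodAsc u (p+2)) ^ (p+3) = 1)
    (X Y : G) (hX : prodAsc a (p+2) = a 1 * X) (hY : prodDesc u (p+2) = Y * u 1)
    (hD : a 1 * (X * Y) * a 1 = X * Y) :
    prodAsc a (p+2) ^ 2 = prodAsc u (p+2) ^ 2 := by
  have uu : ∀ m i, 1 ≤ i → i + 1 ≤ m → m ≤ p+2 →
      prodAsc u m * u i = u (i+1) * prodAsc u m := by
    refine asc_shift u u u (p+2) (fun i j a b c => hu1 j i a b c)
      (fun i j a b c => (hu1 i j a b c).symm) (fun i a b => ?_)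
    rw [hu2 i a b, mul_assoc]
  have uud : ∀ m i, 1 ≤ i → i + 1 ≤ m → m ≤ p+2 →
      prodDesc u m * u (i+1) = u i * prodDesc u m := by
    refine desc_shift u u (p+2) (fun i j a b c => hu1 j i a b c)
      (fun i j a b c => (hu1 i j a b c).symm) (fun i a b => ?_)
    rw [← hu2 i a b, mul_assoc]
  have ua : ∀ m i, 1 ≤ i → i + 1 ≤ m → m ≤ p+2 →
      prodAsc u m * a i = a (i+1) * prodAsc u m := by
    refine asc_shift u a a (p+2)
      (fun i j a b c => (hC1 i j (by omega) (by omega) (by omega) (by omega) (by omega)).symm)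
      (fun i j a b c => (hC1 i j (by omega) (by omega) (by omega) (by omega) (by omega)).symm)
      (fun i a b => ?_)
    rw [← hC3 i a (by omega), mul_assoc]
  have uad : ∀ m i, 1 ≤ i → i + 1 ≤ m → m ≤ p+2 →
      prodDesc u m * a (i+1) = a i * prodDesc u m := by
    refine desc_shift u a (p+2)
      (fun i j a b c => (hC1 i j (by omega) (by omega) (by omega) (by omega) (by omega)).symm)
      (fun i j a b c => (hC1 i j (by omega) (by omega) (by omega) (by omega) (by omega)).symm)
      (fun i a b => ?_)
    rw [← hC2 i a (by omega), mul_assoc]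
  have aa : ∀ m i, 1 ≤ i → i + 1 ≤ m → m ≤ p+2 →
      prodAsc a m * a i = a (i+1) * prodAsc a m := by
    refine asc_shift a a a (p+2) (fun i j a b c => ha1 j i a b c)
      (fun i j a b c => (ha1 i j a b c).symm) (fun i a b => ?_)
    rw [ha2 i a b, mul_assoc]
  -- general (C5)
  have C5 : ∀ k, k + 2 ≤ p + 2 →
      u (k+2) * a (k+1) * a (k+2) * u (k+1) = a (k+1) * a (k+2) := by
    intro k
    induction k with
    | zero => intro _; exact hC5
    | succ k ih =>
      intro hk
      have h := ih (by omega)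
      have s1 := uu (p+2) (k+2) (by omega) (by omega) le_rfl
      have s2 := uu (p+2) (k+1) (by omega) (by omega) le_rfl
      have s3 := ua (p+2) (k+2) (by omega) (by omega) le_rfl
      have s4 := ua (p+2) (k+1) (by omega) (by omega) le_rfl
      generalize prodAsc u (p+2) = U at s1 s2 s3 s4
      have t1 : SemiconjBy U (u (k+2)) (u (k+1+2)) := s1
      have t2 : SemiconjBy U (u (k+1)) (u (k+1+1)) := s2
      have t3 : SemiconjBy U (a (k+2)) (a (k+1+2)) := s3
      have t4 : SemiconjBy U (a (k+1)) (a (k+1+1)) := s4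
      have l := ((t1.mul_right t4).mul_right t3).mul_right t2
      have r := t4.mul_right t3
      rw [h] at l
      exact mul_right_cancel (l.eq.symm.trans r.eq)
  have au : ∀ m i, 1 ≤ i → i + 1 ≤ m → m ≤ p+2 →
      prodAsc a m * u i = (u (i+1))⁻¹ * prodAsc a m := by
    refine asc_shift a u (fun i => (u i)⁻¹) (p+2)
      (fun i j a1 b c => ?_)
      (fun i j a b c => hC1 j i (by omega) (by omega) (by omega) (by omega) (by omega))
      (fun i a b => ?_)
    · have : Commute (a j) (u i) := hC1 j i (by omega) (by omega) (by omega) (by omega) (by omega)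
      exact this.inv_right.eq
    · obtain ⟨k, rfl⟩ : ∃ k, i = k + 1 := ⟨i - 1, by omega⟩
      have := C5 k (by omega)
      simp only [mul_assoc] at this ⊢
      rw [eq_inv_mul_iff_mul_eq]
      simp only [this]
  -- set up
  have hΔ2 := delta_sq (p+2) u hu1 uu uud (p+2) le_rfl
  have hrev := delta_rev (p+2) u hu1 (p+2) le_rfl
  have hΔe : braidDelta u (p+2+1) = prodAsc u (p+2) * braidDelta u (p+2) := rfl
  have hflip := flip_asc (p+2) a _ (delta_conj (p+2) a u hu1 ua uad hC4 (p+2) le_rfl) (p+2) 0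
    (by omega)
  rw [asc_zero, one_mul] at hflip
  have hinv := fun W h => inv_delta (p+2) u W hu1 h (p+2) le_rfl
  have uu' := fun i h1 h2 => uu (p+2) i h1 h2 le_rfl
  have ua' := fun i h1 h2 => ua (p+2) i h1 h2 le_rfl
  have aa' := fun i h1 h2 => aa (p+2) i h1 h2 le_rfl
  have au' := fun i h1 h2 => au (p+2) i h1 h2 le_rfl
  have hAcomm := fun c h => asc_comm a c (p+2) h
  rw [hB3] at hΔ2
  have hUd : prodDesc u (p+2) = (prodAsc u (p+2))⁻¹ := eq_inv_of_mul_eq_one_left hB4a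
  rw [hUd] at hY hrev
  clear uu uud ua uad aa au C5 hB4a hUd hB3
  generalize prodAsc u (p+2) = U at *
  generalize prodAsc a (p+2) = A at *
  generalize braidDelta u (p+2+1) = D at *
  generalize braidDelta u (p+2) = E at *
  -- W = A U⁻¹ commutes with a i, inverts u i
  have Wa : ∀ i, 1 ≤ i → i ≤ p + 2 → a i * (A * U⁻¹) = (A * U⁻¹) * a i := by
    intro i h1 h2
    by_cases h : 2 ≤ i
    · obtain ⟨i, rfl⟩ : ∃ k, i = k + 1 := ⟨i - 1, by omega⟩
      have e1 : SemiconjBy U (a i) (a (i+1)) := ua' i (by omega) h2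
      have e2 : SemiconjBy A (a i) (a (i+1)) := aa' i (by omega) h2
      exact (e2.mul_left e1.inv_symm_left).eq.symm
    · obtain rfl : i = 1 := by omega
      have e : (a 1)⁻¹ * u 1 = u 1 * a 1 := by
        rw [inv_mul_eq_iff_eq_mul, ← mul_assoc, hC4]
      have e' : u 1 * a 1 = (a 1)⁻¹ * u 1 := e.symm
      have hD' : X * Y * (a 1)⁻¹ = a 1 * (X * Y) := by
        rw [mul_inv_eq_iff_eq_mul, hD]
      rw [hX, hY]
      calc a 1 * (a 1 * X * (Y * u 1)) = a 1 * (a 1 * (X * Y)) * u 1 := by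
            simp only [mul_assoc]
        _ = a 1 * X * Y * ((a 1)⁻¹ * u 1) := by rw [← hD']; simp only [mul_assoc]
        _ = _ := by rw [e]; simp only [mul_assoc]
  have WA : Commute A (A * U⁻¹) := hAcomm _ Wa
  have UA : Commute A U := by
    have : Commute A (A⁻¹ * (A * U⁻¹)) := (Commute.refl A).inv_right.mul_right WA
    rw [inv_mul_cancel_left] at this
    simpa using this.inv_right
  have WU : Commute U (A * U⁻¹) := UA.symm.mul_right (Commute.refl U).inv_right
  have Wu2 : ∀ i, 1 ≤ i → i + 1 ≤ p + 2 → SemiconjBy (A * U⁻¹) (u (i+1)) (u (i+1))⁻¹ := by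
    intro i h1 h2
    have e1 : SemiconjBy U (u i) (u (i+1)) := uu' i h1 h2
    have e2 : SemiconjBy A (u i) (u (i+1))⁻¹ := au' i h1 h2
    exact e2.mul_left e1.inv_symm_left
  have Wu1 : SemiconjBy (A * U⁻¹) (u 1) (u 1)⁻¹ := by
    have e1 : SemiconjBy U (u 1) (u 2) := uu' 1 le_rfl (by omega)
    have e2 := Wu2 1 le_rfl (by omega)
    have e3 := (e1.inv_right.inv_symm_left.mul_left e2).mul_left e1
    have : U⁻¹ * (A * U⁻¹) * U = A * U⁻¹ := by
      rw [mul_assoc, ← WU.eq, inv_mul_cancel_left]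
    rwa [this] at e3
  have Wu : ∀ i, 1 ≤ i → i ≤ p + 2 → u i * (A * U⁻¹) * u i = A * U⁻¹ := by
    intro i h1 h2
    have key : SemiconjBy (A * U⁻¹) (u i) (u i)⁻¹ := by
      by_cases h : 2 ≤ i
      · obtain ⟨i, rfl⟩ : ∃ k, i = k + 1 := ⟨i - 1, by omega⟩
        exact Wu2 i (by omega) h2
      · obtain rfl : i = 1 := by omega
        exact Wu1
    rw [mul_assoc, key.eq, mul_inv_cancel_left]
  have f1 := hinv _ Wu
  -- D commutes with W since D² = 1
  have hDi : D⁻¹ = D := inv_eq_of_mul_eq_one_left hΔ2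
  have f2 : Commute D (A * U⁻¹) := by
    have : D * (A * U⁻¹) = (A * U⁻¹) * D⁻¹ := by rw [eq_mul_inv_iff_mul_eq, f1]
    rwa [hDi] at this
  -- D inverts A and U
  have f3 : SemiconjBy D A A⁻¹ := by
    have : D * A = A⁻¹ * D := by
      rw [eq_inv_mul_iff_mul_eq, ← mul_assoc, ← hflip]
    exact this
  have f4 : SemiconjBy D U U⁻¹ := by
    have h : D = E * U⁻¹ := by rw [hΔe, hrev]
    have : D * U = U⁻¹ * D := by
      nth_rw 1 [h]
      rw [hΔe]; group
    exact this
  have f5 := f3.mul_right f4.inv_right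
  have f6 : A * U⁻¹ = A⁻¹ * U⁻¹⁻¹ := mul_right_cancel (f2.eq.symm.trans f5.eq)
  rw [inv_inv, mul_inv_eq_iff_eq_mul, mul_assoc, eq_inv_mul_iff_mul_eq] at f6
  rw [pow_two, pow_two, f6]

/-- relation (E6): (a_1 ⋯ a_{g-1})^k = 1 with k = g if g is even and
k = 2g if g is odd. -/
theorem rel_E6 (g : ℕ) (a u : ℕ → G)
    (ha1 : ∀ i j, 1 ≤ i → i + 2 ≤ j → j ≤ g - 1 → a i * a j = a j * a i)
    (ha2 : ∀ i, 1 ≤ i → i + 1 ≤ g - 1 → a i * a (i + 1) * a i = a (i + 1) * a i * a (i + 1))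
    (hu1 : ∀ i j, 1 ≤ i → i + 2 ≤ j → j ≤ g - 1 → u i * u j = u j * u i)
    (hu2 : ∀ i, 1 ≤ i → i + 1 ≤ g - 1 → u i * u (i + 1) * u i = u (i + 1) * u i * u (i + 1))
    (hC1 : ∀ i j, 1 ≤ i → i ≤ g - 1 → 1 ≤ j → j ≤ g - 1 → (i + 2 ≤ j ∨ j + 2 ≤ i) →
      a i * u j = u j * a i)
    (hC2 : ∀ i, 1 ≤ i → i ≤ g - 2 → a i * u (i + 1) * u i = u (i + 1) * u i * a (i + 1))
    (hC3 : ∀ i, 1 ≤ i → i ≤ g - 2 → a (i + 1) * u i * u (i + 1) = u i * u (i + 1) * a i)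
    (hC4 : a 1 * u 1 * a 1 = u 1)
    (hC5 : u 2 * a 1 * a 2 * u 1 = a 1 * a 2)
(hB4a : prodDesc u (g - 1) * prodAsc u (g - 1) = 1)
    (hB3 : (prodAsc u (g - 1)) ^ g = 1)
    (hD : a 1 * (((List.range (g - 2)).map (fun i => a (i + 2))).prod *
            (((List.range (g - 2)).reverse).map (fun i => u (i + 2))).prod) * a 1 =
          ((List.range (g - 2)).map (fun i => a (i + 2))).prod *
            (((List.range (g - 2)).reverse).map (fun i => u (i + 2))).prod)
    :
    (prodAsc a (g - 1)) ^ (if Even g then g else 2 * g) = 1 := by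
  by_cases h3 : g ≤ 2
  · interval_cases g
    · simp [asc_zero]
    · simp [asc_zero]
    · simpa [prodAsc, pow_two] using hD
  obtain ⟨p, rfl⟩ : ∃ p, g = p + 3 := ⟨g - 3, by omega⟩
  have B3 : prodAsc u (p + 2) ^ (p + 3) = 1 := hB3
  change prodAsc a (p + 2) ^ _ = 1
  have E5 := rel_E5 p a u ha1 ha2 hu1 hu2 hC1 hC2 hC3 hC4 hC5 hB4a hB3 _ _
    (asc_cons a (p+1)) (desc_cons u (p+1)) hD
  split_ifs with h
  · obtain ⟨k, hk⟩ := h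
    rw [hk, ← two_mul, pow_mul] at B3 ⊢
    rw [E5, B3]
  · rw [pow_mul, E5, ← pow_mul, mul_comm, pow_mul, B3, one_pow]
end

section
/- Let g = 4 and let G be a group with elements a_1, a_2, a_3, u_1, u_2, u_3, b satisfying the relations of G¹_{4,0}: the braid relations within (a_i) and within (u_i), a_i b = b a_i for all i, a_i u_j = u_j a_i for |i-j|>1, a_i u_{i+1} u_i = u_{i+1} u_i a_{i+1}, a_{i+1} u_i u_{i+1} = u_i u_{i+1} a_i, a_1 u_1 a_1 = u_1, u_2 a_1 a_2 u_1 = a_1 a_2, (u_3 b)² = (a_1 a_2 a_3)²(u_1 u_2 u_3)², (u_1 u_2 u_3)⁴ = 1, (u_1 u_2)³ = 1. Then, with r = a_1 a_2 a_3 u_3 u_2 u_1, one has ((a_1 a_2 a_3)^{-4} b r)² = 1. -/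
/-- relation (G3) in the group G¹_{4,0}:
((a_1 a_2 a_3)⁻⁴ b r)² = 1 where r = a_1 a_2 a_3 u_3 u_2 u_1. -/
theorem rel_G3 {G : Type*} [Group G] (a1 a2 a3 u1 u2 u3 b : G)
(ha12 : a1 * a2 * a1 = a2 * a1 * a2) (ha23 : a2 * a3 * a2 = a3 * a2 * a3)
    (ha13 : a1 * a3 = a3 * a1)
    (hu12 : u1 * u2 * u1 = u2 * u1 * u2) (hu23 : u2 * u3 * u2 = u3 * u2 * u3)
    (hu13 : u1 * u3 = u3 * u1)
    (hb1 : a1 * b = b * a1) (hb2 : a2 * b = b * a2) (hb3 : a3 * b = b * a3)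
    (hC1a : a1 * u3 = u3 * a1) (hC1b : a3 * u1 = u1 * a3)
    (hC2a : a1 * u2 * u1 = u2 * u1 * a2) (hC2b : a2 * u3 * u2 = u3 * u2 * a3)
    (hC3a : a2 * u1 * u2 = u1 * u2 * a1) (hC3b : a3 * u2 * u3 = u2 * u3 * a2)
    (hC4 : a1 * u1 * a1 = u1)
    (hC5 : u2 * a1 * a2 * u1 = a1 * a2)
    (hC6 : (u3 * b) ^ 2 = (a1 * a2 * a3) ^ 2 * (u1 * u2 * u3) ^ 2)
    (hD4 : (u1 * u2 * u3) ^ 4 = 1)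
    (hD3 : (u1 * u2) ^ 3 = 1)
    :
    (((a1 * a2 * a3) ^ 4)⁻¹ * b * (a1 * a2 * a3 * u3 * u2 * u1)) ^ 2 = 1 := by
  obtain ⟨V, hV⟩ : ∃ V, V = u1 * u2 * u3 := ⟨_, rfl⟩
  obtain ⟨A, hA⟩ : ∃ A, A = a1 * a2 * a3 := ⟨_, rfl⟩
  rw [← hV, ← hA] at hC6
  rw [← hV] at hD4
  -- action of V
  have V1 : SemiconjBy V u1 u2 := by
    show V * u1 = u2 * V
    calc V * u1 = u1 * u2 * (u3 * u1) := by rw [hV]; group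
      _ = (u1 * u2 * u1) * u3 := by rw [← hu13]; group
      _ = u2 * V := by rw [hu12, hV]; group
  have V2 : SemiconjBy V u2 u3 := by
    show V * u2 = u3 * V
    calc V * u2 = u1 * (u2 * u3 * u2) := by rw [hV]; group
      _ = (u1 * u3) * u2 * u3 := by rw [hu23]; group
      _ = u3 * V := by rw [hu13, hV]; group
  have Va1 : SemiconjBy V a1 a2 := by
    show V * a1 = a2 * V
    calc V * a1 = u1 * u2 * (u3 * a1) := by rw [hV]; group
      _ = (u1 * u2 * a1) * u3 := by rw [← hC1a]; group
      _ = a2 * V := by rw [← hC3a, hV]; group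
  have Va2 : SemiconjBy V a2 a3 := by
    show V * a2 = a3 * V
    calc V * a2 = u1 * (u2 * u3 * a2) := by rw [hV]; group
      _ = (u1 * a3) * u2 * u3 := by rw [← hC3b]; group
      _ = a3 * V := by rw [← hC1b, hV]; group
  -- action of A
  have Aa1 : SemiconjBy A a1 a2 := by
    show A * a1 = a2 * A
    calc A * a1 = a1 * a2 * (a3 * a1) := by rw [hA]; group
      _ = (a1 * a2 * a1) * a3 := by rw [← ha13]; group
      _ = a2 * A := by rw [ha12, hA]; group
  have Aa2 : SemiconjBy A a2 a3 := by
    show A * a2 = a3 * A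
    calc A * a2 = a1 * (a2 * a3 * a2) := by rw [hA]; group
      _ = (a1 * a3) * a2 * a3 := by rw [ha23]; group
      _ = a3 * A := by rw [ha13, hA]; group
  have A1 : SemiconjBy A u1 u2⁻¹ := by
    show A * u1 = u2⁻¹ * A
    calc A * u1 = a1 * a2 * (a3 * u1) := by rw [hA]; group
      _ = u2⁻¹ * (u2 * a1 * a2 * u1) * a3 := by rw [hC1b]; group
      _ = u2⁻¹ * A := by rw [hC5, hA]; group
  have hC5' : u3 * a2 * a3 * u2 = a2 * a3 := by
    have h : SemiconjBy V (u2 * a1 * a2 * u1) (u3 * a2 * a3 * u2) :=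
      ((V2.mul_right Va1).mul_right Va2).mul_right V1
    rw [hC5] at h
    have h2 : SemiconjBy V (a1 * a2) (a2 * a3) := Va1.mul_right Va2
    exact mul_right_cancel (h.eq.symm.trans h2.eq)
  have A2 : SemiconjBy A u2 u3⁻¹ := by
    show A * u2 = u3⁻¹ * A
    calc A * u2 = u3⁻¹ * (u3 * a1) * a2 * a3 * u2 := by rw [hA]; group
      _ = u3⁻¹ * a1 * (u3 * a2 * a3 * u2) := by rw [← hC1a]; group
      _ = u3⁻¹ * A := by rw [hC5', hA]; group
  -- the element U = u3 u2 u1 is the inverse of V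
  have hUV : u3 * u2 * u1 * V = 1 := by
    have e1 : V * u1 = u2 * V := V1
    have e2 : V * u2 = u3 * V := V2
    calc u3 * u2 * u1 * V = (u1 * u2) ^ 3 * (u3 * u2 * u1 * V) := by rw [hD3, one_mul]
      _ = u1 * u2 * (u1 * u2) * (u1 * u2 * u3) * u2 * u1 * V := by
          simp only [pow_succ, pow_zero, one_mul, mul_assoc]
      _ = u1 * u2 * (u1 * u2) * (V * u2) * u1 * V := by rw [← hV]; group
      _ = u1 * u2 * (u1 * u2 * u3) * (V * u1) * V := by rw [e2]; group
      _ = u1 * u2 * V * (u2 * V) * V := by rw [← hV, e1]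
      _ = u1 * u2 * (V * u2) * V * V := by group
      _ = (u1 * u2 * u3) * V * V * V := by rw [e2]; group
      _ = V ^ 4 := by rw [← hV]; simp only [pow_succ, pow_zero, one_mul]
      _ = 1 := hD4
  have hU : u3 * u2 * u1 = V⁻¹ := eq_inv_of_mul_eq_one_left hUV
  have VV1 : SemiconjBy (V ^ 2) u1 u3 := by
    rw [pow_two]; exact V2.mul_left V1
  have hVi : (V ^ 2)⁻¹ = V ^ 2 := by
    apply inv_eq_of_mul_eq_one_left
    rw [← pow_add]; exact hD4
  have VV3 : SemiconjBy (V ^ 2) u3 u1 := by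
    have := VV1.inv_symm_left
    rwa [hVi] at this
  have AA1 : SemiconjBy (A ^ 2) u1 u3 := by
    rw [pow_two]
    have := A2.inv_right.mul_left A1
    rwa [inv_inv] at this
  have bA : Commute b A := by
    rw [hA]
    exact (Commute.mul_right (Commute.mul_right hb1.symm hb2.symm) hb3.symm)
  have bA2 : b * A ^ 2 = A ^ 2 * b := (bA.pow_right 2).eq
  -- b commutes with V^2
  have bV : Commute b (V ^ 2) := by
    have h1 : A ^ 2 * u1 = u3 * A ^ 2 := AA1
    have h2 : V ^ 2 * u3 = u1 * V ^ 2 := VV3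
    have h4 : A ^ 2 * (b * V ^ 2) = A ^ 2 * (V ^ 2 * b) := by
      calc A ^ 2 * (b * V ^ 2) = (A ^ 2 * b) * V ^ 2 := by rw [mul_assoc]
        _ = b * (A ^ 2 * V ^ 2) := by rw [← bA2, mul_assoc]
        _ = u3⁻¹ * (u3 * b) ^ 2 * (u3 * b) := by rw [← hC6, pow_two]; group
        _ = u3⁻¹ * A ^ 2 * (V ^ 2 * u3) * b := by rw [hC6]; simp only [mul_assoc]
        _ = u3⁻¹ * (A ^ 2 * u1) * V ^ 2 * b := by rw [h2]; simp only [mul_assoc]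
        _ = A ^ 2 * (V ^ 2 * b) := by rw [h1]; group
    exact mul_left_cancel h4
  -- the products b u b
  have P3 : b * u3 * b = u3⁻¹ * A ^ 2 * V ^ 2 := by
    calc b * u3 * b = u3⁻¹ * (u3 * b) ^ 2 := by rw [pow_two]; group
      _ = _ := by rw [hC6, mul_assoc]
  have bAi : SemiconjBy A⁻¹ b b := (bA.symm.inv_left : Commute A⁻¹ b)
  have P2 : b * u2⁻¹ * b = u2 * A * V ^ 2 * A := by
    have k : SemiconjBy A⁻¹ u3 u2⁻¹ := by
      have := A2.inv_right.inv_symm_left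
      rwa [inv_inv] at this
    have h := ((bAi.mul_right k).mul_right bAi).eq
    rw [P3] at h
    have k2 := k.inv_right.eq
    rw [inv_inv] at k2
    calc b * u2⁻¹ * b = (b * u2⁻¹ * b * A⁻¹) * A := by group
      _ = (A⁻¹ * u3⁻¹) * A ^ 2 * V ^ 2 * A := by rw [← h]; simp only [mul_assoc]
      _ = _ := by rw [k2]; group
  have P1 : b * u1 * b = u1⁻¹ * V ^ 2 * A ^ 2 := by
    have q : SemiconjBy (V ^ 2) b b := bV.symm
    have h := ((q.mul_right VV3).mul_right q).eq
    rw [P3] at h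
    have k : SemiconjBy (A ^ 2) u1⁻¹ u3⁻¹ := AA1.inv_right
    have k' : u3⁻¹ * A ^ 2 = A ^ 2 * u1⁻¹ := k.eq.symm
    have l : V ^ 2 * u3⁻¹ = u1⁻¹ * V ^ 2 := VV3.inv_right.eq
    calc b * u1 * b = (b * u1 * b * V ^ 2) * (V ^ 2)⁻¹ := by group
      _ = (V ^ 2 * u3⁻¹) * A ^ 2 * V ^ 2 * (V ^ 2)⁻¹ := by rw [← h]; simp only [mul_assoc]
      _ = _ := by rw [l]; group
  -- the element s
  obtain ⟨s, hs⟩ : ∃ s, s = V⁻¹ * A := ⟨_, rfl⟩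
  have hAs : A = V * s := by rw [hs]; group
  have s1 : SemiconjBy s u1 u1⁻¹ := by
    rw [hs]; exact (V1.inv_right.inv_symm_left).mul_left A1
  have s2 : SemiconjBy s u2 u2⁻¹ := by
    rw [hs]; exact (V2.inv_right.inv_symm_left).mul_left A2
  obtain ⟨c, hc⟩ : ∃ c, c = s * s := ⟨_, rfl⟩
  have c1 : Commute c u1 := by
    have := s1.inv_right.mul_left s1
    rw [inv_inv, ← hc] at this; exact this
  have c2 : Commute c u2 := by
    have := s2.inv_right.mul_left s2
    rw [inv_inv, ← hc] at this; exact this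
  have A2' : u3⁻¹ * A = A * u2 := A2.eq.symm
  have A2'' : u3 * A = A * u2⁻¹ := by
    have := A2.inv_right.eq.symm
    rwa [inv_inv] at this
  have bVb : b * V * b = V ^ 3 * c * V ^ 2 := by
    have e1 : A⁻¹ * u2⁻¹ = u1 * A⁻¹ := A1.inv_symm_left.eq
    have e2 : A⁻¹ * u3⁻¹ = u2 * A⁻¹ := A2.inv_symm_left.eq
    have e3 : V ^ 2 * u3⁻¹ = u1⁻¹ * V ^ 2 := VV3.inv_right.eq
    have e4 : V⁻¹ * u3 = u2 * V⁻¹ := V2.inv_symm_left.eq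
    calc b * V * b = (b * u1 * b) * (b * u2⁻¹ * b)⁻¹ * (b * u3 * b) := by rw [hV]; group
      _ = (u1⁻¹ * V ^ 2) * A * (V ^ 2)⁻¹ * (A⁻¹ * u2⁻¹) * u3⁻¹ * A ^ 2 * V ^ 2 := by
          rw [P1, P2, P3]; group
      _ = (V ^ 2 * u3⁻¹) * A * (V ^ 2)⁻¹ * u1 * (A⁻¹ * u3⁻¹) * A ^ 2 * V ^ 2 := by
          rw [e1, e3]; group
      _ = V ^ 2 * (u3⁻¹ * A) * (V ^ 2)⁻¹ * (u1 * u2 * u3) * (u3⁻¹ * A) * V ^ 2 := by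
          rw [e2]; group
      _ = V ^ 2 * A * (u2 * V⁻¹) * A * u2 * V ^ 2 := by
          rw [← hV, A2']; group
      _ = V ^ 2 * A * V⁻¹ * (u3 * A) * u2 * V ^ 2 := by rw [← e4]; group
      _ = V ^ 2 * A * V⁻¹ * A * V ^ 2 := by rw [A2'']; group
      _ = V ^ 3 * c * V ^ 2 := by rw [hAs, hc]; group
  have cV2 : Commute (V ^ 2) c := by
    have h : Commute (V ^ 2) (b * V * b) :=
      (bV.symm.mul_right (Commute.pow_self V 2)).mul_right bV.symm
    have h' : c = (V ^ 3)⁻¹ * (b * V * b) * (V ^ 2)⁻¹ := by rw [bVb]; group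
    rw [h']
    exact (((Commute.pow_pow_self V 2 3).inv_right).mul_right h).mul_right
      (Commute.refl (V ^ 2)).inv_right
  have c3 : Commute c u3 := by
    have : u3 = V ^ 2 * u1 * (V ^ 2)⁻¹ := by rw [VV1.eq]; group
    rw [this]
    exact (cV2.symm.mul_right c1).mul_right cV2.symm.inv_right
  have cV : Commute c V := by
    rw [hV]; exact (c1.mul_right c2).mul_right c3
  have cs : Commute c s := by
    rw [hc]; exact (Commute.refl s).mul_left (Commute.refl s)
  -- the half twist D inverts s
  obtain ⟨D, hD⟩ : ∃ D, D = u1 * u2 * u1 := ⟨_, rfl⟩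
  have DD : D * D = 1 := by
    calc D * D = (u1 * u2 * u1) * (u2 * u1 * u2) := by rw [← hu12, hD]
      _ = (u1 * u2) ^ 3 := by simp only [pow_succ, pow_zero, one_mul, mul_assoc]
      _ = 1 := hD3
  have Di : D⁻¹ = D := inv_eq_of_mul_eq_one_left DD
  have Da1 : SemiconjBy D a1 a2⁻¹ := by
    have h1 : SemiconjBy u1 a1 a1⁻¹ := by
      show u1 * a1 = a1⁻¹ * u1
      calc u1 * a1 = a1⁻¹ * (a1 * u1 * a1) := by group
        _ = _ := by rw [hC4]
    have h2 : SemiconjBy (u1 * u2) a1 a2 := by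
      show u1 * u2 * a1 = a2 * (u1 * u2)
      rw [← hC3a, mul_assoc]
    rw [hD]
    exact h2.inv_right.mul_left h1
  have Da2 : SemiconjBy D a2 a1⁻¹ := by
    have := Da1.inv_right.inv_symm_left
    rwa [Di, inv_inv] at this
  have DVD : D * V * D = V⁻¹ := by
    have e : (u2 * u1) ^ 3 = 1 := by
      calc (u2 * u1) ^ 3 = u1⁻¹ * (u1 * u2) ^ 3 * u1 := by
            simp only [pow_succ, pow_zero, one_mul, mul_assoc, inv_mul_cancel_left]
        _ = 1 := by rw [hD3]; group
    have d1 : D * u1 = u2 * D := by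
      rw [hD]
      calc u1 * u2 * u1 * u1 = (u1 * u2 * u1) * u1 := by group
        _ = u2 * (u1 * u2 * u1) := by nth_rw 1 [hu12]; group
    have d2 : D * u2 = u1 * D := by
      rw [hD]
      calc u1 * u2 * u1 * u2 = u1 * (u2 * u1 * u2) := by group
        _ = u1 * (u1 * u2 * u1) := by rw [hu12]
    calc D * V * D = (D * u1) * u2 * u3 * D := by rw [hV]; group
      _ = u2 * (D * u2) * u3 * D := by rw [d1]; group
      _ = u2 * u1 * D * (u3 * u1) * u2 * u1 := by rw [d2]; nth_rw 2 [hD]; group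
      _ = u2 * u1 * D * u1 * (u3 * u2 * u1) := by rw [← hu13]; group
      _ = u2 * u1 * (u1 * u2 * u1) * u1 * V⁻¹ := by rw [hU, hD]
      _ = (u2 * u1) ^ 3 * V⁻¹ := by
          rw [hu12]; simp only [pow_succ, pow_zero, one_mul, mul_assoc]
      _ = V⁻¹ := by rw [e, one_mul]
  have hE : (V * D) * (V * D) = 1 := by
    calc (V * D) * (V * D) = V * (D * V * D) := by group
      _ = 1 := by rw [DVD]; group
  have Ei : (V * D)⁻¹ = V * D := inv_eq_of_mul_eq_one_left hE
  have E1 : SemiconjBy (V * D) a1 a3⁻¹ := Va2.inv_right.mul_left Da1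
  have E2 : SemiconjBy (V * D) a2 a2⁻¹ := Va1.inv_right.mul_left Da2
  have E3 : SemiconjBy (V * D) a3 a1⁻¹ := by
    have := E1.inv_right.inv_symm_left
    rwa [Ei, inv_inv] at this
  have EA : SemiconjBy (V * D) A A⁻¹ := by
    have h := (E1.mul_right E2).mul_right E3
    rw [← hA] at h
    have : A⁻¹ = a3⁻¹ * a2⁻¹ * a1⁻¹ := by rw [hA]; group
    rw [this]; exact h
  have DA : D * A * D = V⁻¹ * A⁻¹ * V := by
    have h : V * D * A = A⁻¹ * (V * D) := EA
    calc D * A * D = V⁻¹ * (V * D * A) * D := by group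
      _ = V⁻¹ * A⁻¹ * V * (D * D) := by rw [h]; group
      _ = _ := by rw [DD, mul_one]
  have Ds : D * s * D = s⁻¹ := by
    have h : D * V⁻¹ * D = V := by
      have := congrArg (·⁻¹) DVD
      simp only [mul_inv_rev, Di, inv_inv] at this
      rw [mul_assoc]; exact this
    calc D * s * D = D * V⁻¹ * (D * D) * A * D := by rw [DD, hs]; group
      _ = (D * V⁻¹ * D) * (D * A * D) := by group
      _ = s⁻¹ := by rw [h, DA, hs]; group
  have cc : c⁻¹ = c := by
    have cD : Commute c D := by rw [hD]; exact (c1.mul_right c2).mul_right c1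
    calc c⁻¹ = s⁻¹ * s⁻¹ := by rw [hc]; group
      _ = D * s * (D * D) * s * D := by rw [← Ds]; group
      _ = D * c * D := by rw [DD, hc]; group
      _ = c * (D * D) := by rw [← cD.eq]; group
      _ = c := by rw [DD, mul_one]
  have si : s⁻¹ = s * c := by
    calc s⁻¹ = s * (s * s)⁻¹ := by group
      _ = s * c := by rw [← hc, cc]
  -- the identity (Q)
  have Q : u1⁻¹ * V ^ 2 * A⁻¹ * (V ^ 2)⁻¹ * A⁻¹ * u3 * V = A * V * A := by
    have e3 : u1⁻¹ * V ^ 2 = V ^ 2 * u3⁻¹ := VV3.inv_right.eq.symm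
    have e5 : u3 * V = V * u2 := V2.eq.symm
    have e6 : s⁻¹ * u2 = u2⁻¹ * s⁻¹ := by
      have := s2.inv_right.inv_symm_left.eq
      rwa [inv_inv] at this
    have e7 : V * u2⁻¹ = u3⁻¹ * V := V2.inv_right.eq
    have e8 : u1 * u2 * s = s * (u1⁻¹ * u2⁻¹) := by
      have := (s1.inv_right.mul_right s2.inv_right).eq
      rw [inv_inv, inv_inv] at this
      exact this.symm
    have e9 : u1⁻¹ * u2⁻¹ * u3⁻¹ = V := by
      have := congrArg (·⁻¹) hU
      simp only [mul_inv_rev, inv_inv] at this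
      rw [mul_assoc]; exact this
    have hV3 : (V ^ 3)⁻¹ = V := by
      apply inv_eq_of_mul_eq_one_left
      rw [← hD4]; group
    have cu : s * c * u3⁻¹ = s * u3⁻¹ * c := by
      rw [mul_assoc, c3.inv_right.eq, mul_assoc]
    calc u1⁻¹ * V ^ 2 * A⁻¹ * (V ^ 2)⁻¹ * A⁻¹ * u3 * V
        = (u1⁻¹ * V ^ 2) * s⁻¹ * (V ^ 3)⁻¹ * s⁻¹ * V⁻¹ * (u3 * V) := by rw [hAs]; group
      _ = (u1⁻¹ * V ^ 2) * s⁻¹ * V * (s⁻¹ * u2) := by rw [hV3, e5]; group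
      _ = V ^ 2 * u3⁻¹ * s⁻¹ * (V * u2⁻¹) * s⁻¹ := by rw [e6, e3]; group
      _ = V * (V * u3⁻¹) * s⁻¹ * u3⁻¹ * V * s⁻¹ := by rw [e7, pow_two]; group
      _ = V * (u1 * u2) * (s * c * u3⁻¹) * V * s⁻¹ := by
          rw [si]; nth_rw 2 [hV]; group
      _ = V * (u1 * u2 * s) * u3⁻¹ * (c * V) * s⁻¹ := by rw [cu]; group
      _ = V * s * (u1⁻¹ * u2⁻¹ * u3⁻¹) * V * c * s⁻¹ := by rw [e8, cV.eq]; group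
      _ = A * V * A := by rw [e9, hAs, hc]; group
  -- the identity (G2)
  have G2 : b * V⁻¹ * b = A ^ 3 * V * A ^ 3 := by
    have e1 : u2⁻¹ * u1⁻¹ = u3 * V⁻¹ := by rw [hV]; group
    have k' : u3⁻¹ * A ^ 2 = A ^ 2 * u1⁻¹ := AA1.inv_right.eq.symm
    calc b * V⁻¹ * b = (b * u3 * b) * (b * u2⁻¹ * b)⁻¹ * (b * u1 * b) := by rw [← hU]; group
      _ = (u3⁻¹ * A ^ 2) * V ^ 2 * A⁻¹ * (V ^ 2)⁻¹ * A⁻¹ * (u2⁻¹ * u1⁻¹) * V ^ 2 * A ^ 2 := by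
          rw [P1, P2, P3]; group
      _ = A ^ 2 * (u1⁻¹ * V ^ 2 * A⁻¹ * (V ^ 2)⁻¹ * A⁻¹ * u3 * V) * A ^ 2 := by
          rw [k', e1]; group
      _ = A ^ 3 * V * A ^ 3 := by rw [Q]; group
  have hr : a1 * a2 * a3 * u3 * u2 * u1 = A * V⁻¹ := by rw [← hU, hA]; group
  rw [hr, ← hA]
  have bA3 : (A ^ 3)⁻¹ * b = b * (A ^ 3)⁻¹ := ((bA.pow_right 3).inv_right).eq.symm
  have bA4 : (A ^ 4)⁻¹ * b = b * (A ^ 4)⁻¹ := ((bA.pow_right 4).inv_right).eq.symm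
  calc ((A ^ 4)⁻¹ * b * (A * V⁻¹)) ^ 2
      = ((A ^ 4)⁻¹ * b) * A * V⁻¹ * (((A ^ 4)⁻¹ * b) * A * V⁻¹) := by rw [pow_two]; group
    _ = (b * (A ^ 3)⁻¹) * V⁻¹ * ((b * (A ^ 3)⁻¹) * V⁻¹) := by rw [bA4]; group
    _ = (A ^ 3)⁻¹ * (b * V⁻¹ * b) * (A ^ 3)⁻¹ * V⁻¹ := by rw [← bA3]; nth_rw 2 [bA3]; group
    _ = 1 := by rw [G2]; group
end
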